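/- For every integer n ≥ 1 and each pattern σ ∈ {123, 132}, the number of desarrangements of length n avoiding all three patterns 213, 231, and σ equals ⌊n/2⌋, i.e. d_n({213, 231, σ}) = ⌊n/2⌋; moreover d_n({132, 231, 312}) = ⌊n/2⌋ for every integer n ≥ 1. -/

import Mathlib

open scoped Classical

/-- Index `i ∈ {1,…,n}` (1-indexed) is an ascent of the permutation `π` of length `n`,
written in one-line notation `π₁π₂⋯πₙ` with `πᵢ = π ⟨i-1, _⟩`: either `i = n`, or
`πᵢ < πᵢ₊₁`. -/
def IsAscent (n : ℕ) (π : Equiv.Perm (Fin n)) (i : ℕ) : Prop :=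
  1 ≤ i ∧ i ≤ n ∧ (i = n ∨ ∃ h : i < n, π ⟨i - 1, by omega⟩ < π ⟨i, h⟩)

/-- A permutation is a desarrangement if it is empty or its first (smallest) ascent is even. -/
def IsDesarrangement (n : ℕ) (π : Equiv.Perm (Fin n)) : Prop :=
  n = 0 ∨ ∃ i, IsAscent n π i ∧ Even i ∧ ∀ j, IsAscent n π j → i ≤ j

/-- `π` contains the pattern `σ` (where `σ` is given in 0-indexed one-line notation):
there are positions `i₁ < ⋯ < i_k` such that the letters of `π` at these positions are
in the same relative order as the letters of `σ`. -/
def ContainsPattern {k n : ℕ} (σ : Fin k → Fin k) (π : Equiv.Perm (Fin n)) : Prop :=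
  ∃ f : Fin k ↪o Fin n, ∀ a b : Fin k, π (f a) < π (f b) ↔ σ a < σ b

/-- `d_n(P)`: the number of desarrangements of length `n` avoiding every pattern in `P`
(patterns of length 3, in 0-indexed one-line notation). -/
noncomputable def dcount (n : ℕ) (P : Finset (Fin 3 → Fin 3)) : ℕ :=
  (Finset.univ.filter fun π : Equiv.Perm (Fin n) =>
    IsDesarrangement n π ∧ ∀ σ ∈ P, ¬ ContainsPattern σ π).card

/-- The (0-indexed) position `m` is the first ascent of `π`. -/
def IsFirstAscent {n : ℕ} (π : Equiv.Perm (Fin n)) (m : Fin n) : Prop :=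
  (∀ a b : Fin n, b.val = a.val + 1 → a < m → π b < π a) ∧
    ∀ b : Fin n, b.val = m.val + 1 → π m < π b

theorem isAscent_succ_iff {n : ℕ} (π : Equiv.Perm (Fin n)) (m : Fin n) :
    IsAscent n π (m.val + 1) ↔ ∀ b : Fin n, b.val = m.val + 1 → π m < π b := by
  constructor
  · rintro ⟨-, -, h | ⟨h, hlt⟩⟩ b hb
    · have := b.isLt
      omega
    · have hb' : b = ⟨m.val + 1, h⟩ := Fin.ext hb
      rw [hb']
      exact hlt
  · intro h
    refine ⟨by omega, m.isLt, ?_⟩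
    by_cases hm : m.val + 1 = n
    · exact Or.inl hm
    · have hlt : m.val + 1 < n := by have := m.isLt; omega
      exact Or.inr ⟨hlt, h ⟨m.val + 1, hlt⟩ rfl⟩

theorem isFirstAscent_iff {n : ℕ} (π : Equiv.Perm (Fin n)) (m : Fin n) :
    IsFirstAscent π m ↔
      IsAscent n π (m.val + 1) ∧ ∀ j, IsAscent n π j → m.val + 1 ≤ j := by
  rw [isAscent_succ_iff]
  constructor
  · rintro ⟨hdesc, hasc⟩
    refine ⟨hasc, fun j hj => ?_⟩
    by_contra! hlt
    have hj1 := hj.1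
    have hm := m.isLt
    obtain ⟨i, rfl⟩ : ∃ i, j = i + 1 := ⟨j - 1, by omega⟩
    have h := (isAscent_succ_iff π ⟨i, by omega⟩).1 hj ⟨i + 1, by omega⟩ rfl
    have h' := hdesc ⟨i, by omega⟩ ⟨i + 1, by omega⟩ rfl (Fin.lt_def.2 (by simpa using hlt))
    exact lt_asymm h h'
  · rintro ⟨hasc, hmin⟩
    refine ⟨fun a b hb ham => ?_, hasc⟩
    by_contra! hle
    have hA : IsAscent n π (a.val + 1) := by
      rw [isAscent_succ_iff]
      intro c hc
      have hcb : c = b := Fin.ext (hc.trans hb.symm)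
      subst hcb
      refine lt_of_le_of_ne hle fun h => ?_
      have := congrArg Fin.val (π.injective h)
      omega
    have := hmin _ hA
    have := Fin.lt_def.1 ham
    omega

theorem isDesarrangement_iff {n : ℕ} (hn : 1 ≤ n) (π : Equiv.Perm (Fin n)) :
    IsDesarrangement n π ↔ ∃ m : Fin n, Odd m.val ∧ IsFirstAscent π m := by
  constructor
  · rintro (h | ⟨i, hi, heven, hmin⟩)
    · omega
    · obtain ⟨h1, h2, -⟩ := id hi
      obtain ⟨m, rfl⟩ : ∃ m, i = m + 1 := ⟨i - 1, by omega⟩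
      exact ⟨⟨m, h2⟩, by simpa [Nat.even_add_one] using heven,
        (isFirstAscent_iff π ⟨m, h2⟩).2 ⟨hi, hmin⟩⟩
  · rintro ⟨m, hodd, hm⟩
    obtain ⟨hasc, hmin⟩ := (isFirstAscent_iff π m).1 hm
    exact Or.inr ⟨m.val + 1, hasc, hodd.add_one, hmin⟩

theorem IsFirstAscent.unique {n : ℕ} {π : Equiv.Perm (Fin n)} {m m' : Fin n}
    (h : IsFirstAscent π m) (h' : IsFirstAscent π m') : m = m' := by
  rw [isFirstAscent_iff] at h h'
  have h1 := h.2 _ h'.1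
  have h2 := h'.2 _ h.1
  exact Fin.ext (by omega)

theorem IsFirstAscent.apply_lt_apply {n : ℕ} {π : Equiv.Perm (Fin n)} {m : Fin n}
    (h : IsFirstAscent π m) {a b : Fin n} (hab : a < b) (hbm : b ≤ m) : π b < π a := by
  obtain ⟨a, ha⟩ := a
  obtain ⟨b, hb⟩ := b
  simp only [Fin.lt_def, Fin.le_def] at hab hbm
  induction b, hab using Nat.le_induction with
  | base => exact h.1 _ _ rfl (Fin.lt_def.2 hbm)
  | succ b hab ih =>
    exact (h.1 ⟨b, by omega⟩ ⟨b + 1, hb⟩ rfl (Fin.lt_def.2 hbm)).trans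
      (ih (by omega) (by omega))

theorem containsPattern_three_iff {n : ℕ} {σ : Fin 3 → Fin 3} (hσ : Function.Injective σ)
    (π : Equiv.Perm (Fin n)) :
    ContainsPattern σ π ↔ ∃ a b c : Fin n, a < b ∧ b < c ∧ (π a < π b ↔ σ 0 < σ 1) ∧
      (π a < π c ↔ σ 0 < σ 2) ∧ (π b < π c ↔ σ 1 < σ 2) := by
  constructor
  · rintro ⟨f, hf⟩
    exact ⟨f 0, f 1, f 2, f.strictMono (by decide), f.strictMono (by decide), hf 0 1, hf 0 2,
      hf 1 2⟩
  · rintro ⟨a, b, c, hab, hbc, h01, h02, h12⟩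
    have hmono : StrictMono ![a, b, c] := by
      rw [Fin.strictMono_iff_lt_succ]
      intro i
      fin_cases i
      · exact hab
      · exact hbc
    have hswap : ∀ {x y : Fin n} {i j : Fin 3}, x ≠ y → i ≠ j →
        (π x < π y ↔ σ i < σ j) → (π y < π x ↔ σ j < σ i) := by
      intro x y i j hxy hij h
      have h1 := π.injective.ne hxy
      have h2 := hσ.ne hij
      rw [← not_le, ← not_le, h1.le_iff_lt, h2.le_iff_lt, h]
    refine ⟨OrderEmbedding.ofStrictMono ![a, b, c] hmono, fun i j => ?_⟩
    have h10 := hswap hab.ne (by decide) h01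
    have h20 := hswap (hab.trans hbc).ne (by decide) h02
    have h21 := hswap hbc.ne (by decide) h12
    fin_cases i <;> fin_cases j <;>
      simp only [OrderEmbedding.coe_ofStrictMono] <;>
      first
        | exact iff_of_false (lt_irrefl _) (lt_irrefl _)
        | assumption

theorem perm_eq_of_lt_iff_lt {n : ℕ} {π ρ : Equiv.Perm (Fin n)}
    (h : ∀ a b : Fin n, a < b → (π a < π b ↔ ρ a < ρ b)) : π = ρ := by
  have hmono : StrictMono (π.symm.trans ρ) := by
    intro x y hxy
    obtain ⟨a, rfl⟩ := π.surjective x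
    obtain ⟨b, rfl⟩ := π.surjective y
    simp only [Equiv.trans_apply, Equiv.symm_apply_apply]
    have hne : a ≠ b := fun hab => hxy.ne (congrArg π hab)
    rcases lt_or_gt_of_ne hne with hab | hab
    · exact (h a b hab).1 hxy
    · by_contra! hle
      have hlt := lt_of_le_of_ne hle (ρ.injective.ne hne.symm)
      exact lt_asymm hxy ((h b a hab).2 hlt)
  have hid : (π.symm.trans ρ : Fin n → Fin n) = id :=
    (hmono.range_inj strictMono_id).1
      (by rw [(π.symm.trans ρ).surjective.range_eq, Set.range_id])
  ext a
  have := congrFun hid (π a)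
  simp only [Equiv.trans_apply, Equiv.symm_apply_apply, id] at this
  rw [this]

/-- If for every position `m` there is exactly one permutation avoiding `P` whose first ascent is
`m`, and its one-line notation is `v m`, then `d_n(P) = ⌊n/2⌋`. -/
theorem dcount_eq_half {n : ℕ} (hn : 1 ≤ n) (P : Finset (Fin 3 → Fin 3)) (v : ℕ → ℕ → ℕ)
    (hlt : ∀ m a, m < n → a < n → v m a < n)
    (hne : ∀ m a b, m < n → a < b → b < n → v m a ≠ v m b)
    (hdesc : ∀ m a, m < n → a < m → v m (a + 1) < v m a)
    (hasc : ∀ m, m + 1 < n → v m m < v m (m + 1))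
    (havoid : ∀ (π : Equiv.Perm (Fin n)) (m : Fin n), (∀ a, (π a).val = v m a) →
      ∀ σ ∈ P, ¬ ContainsPattern σ π)
    (huniq : ∀ (π : Equiv.Perm (Fin n)) (m : Fin n), (∀ σ ∈ P, ¬ ContainsPattern σ π) →
      IsFirstAscent π m → ∀ a b : Fin n, a < b → (π a < π b ↔ v m a < v m b)) :
    dcount n P = n / 2 := by
  have hexists : ∀ m : Fin n, ∃ π : Equiv.Perm (Fin n), ∀ a, (π a).val = v m a := by
    intro m
    have hinj : Function.Injective fun a : Fin n => (⟨v m a, hlt m a m.isLt a.isLt⟩ : Fin n) := by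
      intro a b hab
      have hab' : v m a = v m b := congrArg Fin.val hab
      rcases lt_trichotomy a b with h | h | h
      · exact absurd hab' (hne m a b m.isLt h b.isLt)
      · exact h
      · exact absurd hab'.symm (hne m b a m.isLt h a.isLt)
    exact ⟨Equiv.ofBijective _ (Finite.injective_iff_bijective.1 hinj), fun a => rfl⟩
  choose F hF using hexists
  have hfirst : ∀ m, IsFirstAscent (F m) m := by
    refine fun m => ⟨fun a b hb ham => ?_, fun b hb => ?_⟩
    · rw [Fin.lt_def, hF, hF, hb]
      exact hdesc m a m.isLt ham
    · rw [Fin.lt_def, hF, hF, hb]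
      exact hasc m (hb ▸ b.isLt)
  refine Finset.card_eq_of_bijective (fun i hi => F ⟨2 * i + 1, by omega⟩) ?_ ?_ ?_
  · intro π hπ
    obtain ⟨-, hdes, hav⟩ := Finset.mem_filter.1 hπ
    obtain ⟨m, ⟨k, hk⟩, hm⟩ := (isDesarrangement_iff hn π).1 hdes
    have hmlt := m.isLt
    refine ⟨k, by omega, ?_⟩
    have hmk : (⟨2 * k + 1, by omega⟩ : Fin n) = m := Fin.ext hk.symm
    rw [hmk]
    refine perm_eq_of_lt_iff_lt fun a b hab => ?_
    rw [huniq π m hav hm a b hab, Fin.lt_def, hF, hF]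
  · intro i hi
    exact Finset.mem_filter.2 ⟨Finset.mem_univ _, (isDesarrangement_iff hn _).2
      ⟨⟨2 * i + 1, by omega⟩, ⟨i, rfl⟩, hfirst _⟩, havoid _ _ (hF _)⟩
  · intro i j hi hj hij
    have h1 := hfirst ⟨2 * i + 1, by omega⟩
    rw [hij] at h1
    have := congrArg Fin.val (h1.unique (hfirst _))
    simp only at this
    omega

theorem avoids_123_iff {n : ℕ} (π : Equiv.Perm (Fin n)) :
    ¬ ContainsPattern ![0, 1, 2] π ↔
      ∀ a b c : Fin n, a < b → b < c → ¬ (π a < π b ∧ π b < π c) := by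
  have hinj : Function.Injective (![0, 1, 2] : Fin 3 → Fin 3) := by decide
  rw [containsPattern_three_iff hinj]
  constructor
  · rintro h a b c hab hbc ⟨h1, h2⟩
    refine h ⟨a, b, c, hab, hbc, ?_, ?_, ?_⟩ <;> simp <;> order
  · rintro h ⟨a, b, c, hab, hbc, h1, h2, h3⟩
    have hab' := π.injective.ne hab.ne
    have hbc' := π.injective.ne hbc.ne
    have hac' := π.injective.ne (hab.trans hbc).ne
    simp at h1 h2 h3
    exact h a b c hab hbc (by constructor <;> order)

theorem avoids_132_iff {n : ℕ} (π : Equiv.Perm (Fin n)) :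
    ¬ ContainsPattern ![0, 2, 1] π ↔
      ∀ a b c : Fin n, a < b → b < c → ¬ (π a < π c ∧ π c < π b) := by
  have hinj : Function.Injective (![0, 2, 1] : Fin 3 → Fin 3) := by decide
  rw [containsPattern_three_iff hinj]
  constructor
  · rintro h a b c hab hbc ⟨h1, h2⟩
    refine h ⟨a, b, c, hab, hbc, ?_, ?_, ?_⟩ <;> simp <;> order
  · rintro h ⟨a, b, c, hab, hbc, h1, h2, h3⟩
    have hab' := π.injective.ne hab.ne
    have hbc' := π.injective.ne hbc.ne
    have hac' := π.injective.ne (hab.trans hbc).ne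
    simp at h1 h2 h3
    exact h a b c hab hbc (by constructor <;> order)

theorem avoids_213_iff {n : ℕ} (π : Equiv.Perm (Fin n)) :
    ¬ ContainsPattern ![1, 0, 2] π ↔
      ∀ a b c : Fin n, a < b → b < c → ¬ (π b < π a ∧ π a < π c) := by
  have hinj : Function.Injective (![1, 0, 2] : Fin 3 → Fin 3) := by decide
  rw [containsPattern_three_iff hinj]
  constructor
  · rintro h a b c hab hbc ⟨h1, h2⟩
    refine h ⟨a, b, c, hab, hbc, ?_, ?_, ?_⟩ <;> simp <;> order
  · rintro h ⟨a, b, c, hab, hbc, h1, h2, h3⟩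
    have hab' := π.injective.ne hab.ne
    have hbc' := π.injective.ne hbc.ne
    have hac' := π.injective.ne (hab.trans hbc).ne
    simp at h1 h2 h3
    exact h a b c hab hbc (by constructor <;> order)

theorem avoids_231_iff {n : ℕ} (π : Equiv.Perm (Fin n)) :
    ¬ ContainsPattern ![1, 2, 0] π ↔
      ∀ a b c : Fin n, a < b → b < c → ¬ (π c < π a ∧ π a < π b) := by
  have hinj : Function.Injective (![1, 2, 0] : Fin 3 → Fin 3) := by decide
  rw [containsPattern_three_iff hinj]
  constructor
  · rintro h a b c hab hbc ⟨h1, h2⟩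
    refine h ⟨a, b, c, hab, hbc, ?_, ?_, ?_⟩ <;> simp <;> order
  · rintro h ⟨a, b, c, hab, hbc, h1, h2, h3⟩
    have hab' := π.injective.ne hab.ne
    have hbc' := π.injective.ne hbc.ne
    have hac' := π.injective.ne (hab.trans hbc).ne
    simp at h1 h2 h3
    exact h a b c hab hbc (by constructor <;> order)

theorem avoids_312_iff {n : ℕ} (π : Equiv.Perm (Fin n)) :
    ¬ ContainsPattern ![2, 0, 1] π ↔
      ∀ a b c : Fin n, a < b → b < c → ¬ (π b < π c ∧ π c < π a) := by
  have hinj : Function.Injective (![2, 0, 1] : Fin 3 → Fin 3) := by decide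
  rw [containsPattern_three_iff hinj]
  constructor
  · rintro h a b c hab hbc ⟨h1, h2⟩
    refine h ⟨a, b, c, hab, hbc, ?_, ?_, ?_⟩ <;> simp <;> order
  · rintro h ⟨a, b, c, hab, hbc, h1, h2, h3⟩
    have hab' := π.injective.ne hab.ne
    have hbc' := π.injective.ne hbc.ne
    have hac' := π.injective.ne (hab.trans hbc).ne
    simp at h1 h2 h3
    exact h a b c hab hbc (by constructor <;> order)

theorem IsFirstAscent.apply_lt_apply_of_avoids_231 {n : ℕ} {π : Equiv.Perm (Fin n)} {m : Fin n}
    (h : IsFirstAscent π m) (hav : ¬ ContainsPattern ![1, 2, 0] π) {b : Fin n} (hmb : m < b) :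
    π m < π b := by
  rw [avoids_231_iff] at hav
  have hval := Fin.lt_def.1 hmb
  have hlt : m.val + 1 < n := by have := b.isLt; omega
  have hs := h.2 ⟨m.val + 1, hlt⟩ rfl
  by_cases hb : b.val = m.val + 1
  · exact h.2 b hb
  · refine lt_of_le_of_ne (not_lt.1 fun hbm => ?_) (π.injective.ne hmb.ne)
    exact hav m ⟨m.val + 1, hlt⟩ b (Fin.lt_def.2 (Nat.lt_succ_self _))
      (Fin.lt_def.2 (by simp only; omega)) ⟨hbm, hs⟩

theorem dcount_213_231_123 {n : ℕ} (hn : 1 ≤ n) :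
    dcount n {![1,0,2], ![1,2,0], ![0,1,2]} = n / 2 := by
  refine dcount_eq_half hn _
    (fun m a => if a < m then n - 1 - a else if a = m then 0 else n - a) ?_ ?_ ?_ ?_ ?_ ?_
  · grind
  · grind
  · grind
  · grind
  · intro π m hπ
    simp only [Finset.mem_insert, Finset.mem_singleton, forall_eq_or_imp, forall_eq,
      avoids_213_iff, avoids_231_iff, avoids_123_iff, Fin.lt_def, hπ]
    grind
  · intro π m hav hm a b hab
    simp only [Finset.mem_insert, Finset.mem_singleton, forall_eq_or_imp, forall_eq] at hav
    obtain ⟨h213, h231, h123⟩ := hav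
    have hval : (if a.val < m.val then n - 1 - a.val else if a.val = m.val then 0 else n - a.val) <
        (if b.val < m.val then n - 1 - b.val else if b.val = m.val then 0 else n - b.val) ↔ a = m := by
      have := Fin.lt_def.1 hab
      grind
    rw [hval]
    rcases le_or_gt b m with hbm | hmb
    · have := hm.apply_lt_apply hab hbm
      grind
    · have hmb' := hm.apply_lt_apply_of_avoids_231 h231 hmb
      have hne := π.injective.ne hab.ne
      rcases lt_trichotomy a m with ham | rfl | hma
      · have hd := hm.apply_lt_apply ham le_rfl
        have := (avoids_213_iff π).1 h213 a m b ham hmb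
        grind
      · grind
      · have hma' := hm.apply_lt_apply_of_avoids_231 h231 hma
        have := (avoids_123_iff π).1 h123 m a b hma hab
        grind

theorem dcount_213_231_132 {n : ℕ} (hn : 1 ≤ n) :
    dcount n {![1,0,2], ![1,2,0], ![0,2,1]} = n / 2 := by
  refine dcount_eq_half hn _
    (fun m a => if a < m then n - 1 - a else a - m) ?_ ?_ ?_ ?_ ?_ ?_
  · grind
  · grind
  · grind
  · grind
  · intro π m hπ
    simp only [Finset.mem_insert, Finset.mem_singleton, forall_eq_or_imp, forall_eq,
      avoids_213_iff, avoids_231_iff, avoids_132_iff, Fin.lt_def, hπ]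
    grind
  · intro π m hav hm a b hab
    simp only [Finset.mem_insert, Finset.mem_singleton, forall_eq_or_imp, forall_eq] at hav
    obtain ⟨h213, h231, h132⟩ := hav
    have hval : (if a.val < m.val then n - 1 - a.val else a.val - m.val) <
        (if b.val < m.val then n - 1 - b.val else b.val - m.val) ↔ m ≤ a := by
      have := Fin.lt_def.1 hab
      grind
    rw [hval]
    rcases le_or_gt b m with hbm | hmb
    · have := hm.apply_lt_apply hab hbm
      grind
    · have hmb' := hm.apply_lt_apply_of_avoids_231 h231 hmb
      have hne := π.injective.ne hab.ne
      rcases lt_trichotomy a m with ham | rfl | hma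
      · have hd := hm.apply_lt_apply ham le_rfl
        have := (avoids_213_iff π).1 h213 a m b ham hmb
        grind
      · grind
      · have hma' := hm.apply_lt_apply_of_avoids_231 h231 hma
        have := (avoids_132_iff π).1 h132 m a b hma hab
        grind

theorem dcount_132_231_312 {n : ℕ} (hn : 1 ≤ n) :
    dcount n {![0,2,1], ![1,2,0], ![2,0,1]} = n / 2 := by
  refine dcount_eq_half hn _
    (fun m a => if a ≤ m then m - a else a) ?_ ?_ ?_ ?_ ?_ ?_
  · grind
  · grind
  · grind
  · grind
  · intro π m hπ
    simp only [Finset.mem_insert, Finset.mem_singleton, forall_eq_or_imp, forall_eq,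
      avoids_132_iff, avoids_231_iff, avoids_312_iff, Fin.lt_def, hπ]
    grind
  · intro π m hav hm a b hab
    simp only [Finset.mem_insert, Finset.mem_singleton, forall_eq_or_imp, forall_eq] at hav
    obtain ⟨h132, h231, h312⟩ := hav
    have hval : (if a.val ≤ m.val then m.val - a.val else a.val) <
        (if b.val ≤ m.val then m.val - b.val else b.val) ↔ m < b := by
      have := Fin.lt_def.1 hab
      grind
    rw [hval]
    rcases le_or_gt b m with hbm | hmb
    · have := hm.apply_lt_apply hab hbm
      grind
    · have hmb' := hm.apply_lt_apply_of_avoids_231 h231 hmb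
      have hne := π.injective.ne hab.ne
      rcases lt_trichotomy a m with ham | rfl | hma
      · have hd := hm.apply_lt_apply ham le_rfl
        have := (avoids_312_iff π).1 h312 a m b ham hmb
        grind
      · grind
      · have hma' := hm.apply_lt_apply_of_avoids_231 h231 hma
        have := (avoids_132_iff π).1 h132 m a b hma hab
        grind

/-- For every integer `n ≥ 1` and each `σ ∈ {123, 132}`, `d_n({213, 231, σ}) = ⌊n/2⌋`;
moreover `d_n({132, 231, 312}) = ⌊n/2⌋` for every `n ≥ 1`. -/
theorem desarrangements_avoiding_213_231_and_friend (n : ℕ) (hn : 1 ≤ n) :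
    (∀ σ : Fin 3 → Fin 3, (σ = ![0,1,2] ∨ σ = ![0,2,1]) →
      dcount n {![1,0,2], ![1,2,0], σ} = n / 2) ∧
    dcount n {![0,2,1], ![1,2,0], ![2,0,1]} = n / 2 := by
  refine ⟨?_, dcount_132_231_312 hn⟩
  rintro σ (rfl | rfl)
  · exact dcount_213_231_123 hn
  · exact dcount_213_231_132 hn
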